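/- arXiv:2402.06338 — 2 statements merged into one kernel-verified Lean document; each statement's English description precedes it below -/
import Mathlib

section
/- There exists a fragile finite simple graph in which every vertex has degree at least 4 (in fact, minimum degree exactly 4). -/
/-- A graph is `k`-connected if it has at least `k+1` vertices and deleting any set of
at most `k-1` vertices leaves a connected (in particular nonempty) graph. -/
def SimpleGraph.IsKConnected {V : Type*} (G : SimpleGraph V) (k : ℕ) : Prop :=
  k + 1 ≤ Nat.card V ∧ ∀ S : Set V, S.ncard ≤ k - 1 → (G.induce Sᶜ).Connected

/-- A graph is fragile if it has no 3-connected subgraph. -/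
def SimpleGraph.Fragile {V : Type*} (G : SimpleGraph V) : Prop :=
  ∀ H : G.Subgraph, ¬ H.coe.IsKConnected 3

/-- A graph is `m`-fragile if every 3-connected subgraph of it is `(m-1)`-colourable. -/
def SimpleGraph.MFragile {V : Type*} (m : ℕ) (G : SimpleGraph V) : Prop :=
  ∀ H : G.Subgraph, H.coe.IsKConnected 3 → H.coe.Colorable (m - 1)

namespace SimpleGraph

variable {V : Type*} [DecidableEq V] {G : SimpleGraph V}

/-- A 3-connected subgraph lies entirely on one side of any separation of order at most 2. -/
theorem Subgraph.subset_or_subset_of_separation {H : G.Subgraph} (hH : H.coe.IsKConnected 3)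
    {A B : Finset V} (hcard : (A ∩ B).card ≤ 2)
    (hAB : ∀ a ∈ A \ B, ∀ b ∈ B \ A, ¬ G.Adj a b) (hsub : H.verts ⊆ ↑(A ∪ B)) :
    H.verts ⊆ ↑A ∨ H.verts ⊆ ↑B := by
  by_contra! hcon
  obtain ⟨hA, hB⟩ := hcon
  obtain ⟨b, hbH, hbA⟩ := Set.not_subset.1 hA
  obtain ⟨a, haH, haB⟩ := Set.not_subset.1 hB
  have hS : (Subtype.val ⁻¹' (↑(A ∩ B) : Set V) : Set H.verts).ncard ≤ 3 - 1 := by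
    rw [← Set.ncard_image_of_injective _ Subtype.val_injective]
    refine (Set.ncard_le_ncard (Set.image_preimage_subset _ _)
      (Finset.finite_toSet (A ∩ B))).trans ?_
    rwa [Set.ncard_coe_finset]
  have hreach := (hH.2 _ hS).preconnected
    ⟨⟨a, haH⟩, fun h => haB (Finset.mem_inter.1 h).2⟩
    ⟨⟨b, hbH⟩, fun h => hbA (Finset.mem_inter.1 h).1⟩
  rw [reachable_iff_reflTransGen] at hreach
  refine (?_ : b ∉ B) (by simpa [show b ∉ A from hbA] using hsub hbH)
  have key : ∀ y, Relation.ReflTransGen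
      (H.coe.induce (Subtype.val ⁻¹' (↑(A ∩ B) : Set V) : Set H.verts)ᶜ).Adj
      ⟨⟨a, haH⟩, fun h => haB (Finset.mem_inter.1 h).2⟩ y → y.1.1 ∉ B := by
    intro y hy
    induction hy with
    | refl => exact haB
    | @tail x y _ hxy ih =>
      intro hyB
      have hxA : x.1.1 ∈ A := by simpa [ih] using hsub x.1.2
      have hyA : y.1.1 ∉ A := fun h => y.2 (Finset.mem_inter.2 ⟨h, hyB⟩)
      exact hAB _ (Finset.mem_sdiff.2 ⟨hxA, ih⟩) _ (Finset.mem_sdiff.2 ⟨hyB, hyA⟩)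
        (H.adj_sub hxy)
  exact key _ hreach

variable (G) in
/-- A vertex set is separable if it can be split into sets of at most three vertices by
repeatedly passing to the two sides of a separation of order at most 2. -/
inductive IsSeparable : Finset V → Prop
  | small {S : Finset V} : S.card ≤ 3 → IsSeparable S
  | separation {S : Finset V} (A B : Finset V) : S ⊆ A ∪ B → (A ∩ B).card ≤ 2 →
      (∀ a ∈ A \ B, ∀ b ∈ B \ A, ¬ G.Adj a b) → IsSeparable A → IsSeparable B → IsSeparable S

theorem IsSeparable.not_verts_subset {S : Finset V} (hS : G.IsSeparable S) {H : G.Subgraph}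
    (hH : H.coe.IsKConnected 3) : ¬ H.verts ⊆ ↑S := by
  induction hS with
  | small h =>
    intro hsub
    have h₁ := hH.1
    rw [Nat.card_coe_set_eq] at h₁
    have h₂ := Set.ncard_le_ncard hsub (Finset.finite_toSet _)
    rw [Set.ncard_coe_finset] at h₂
    omega
  | separation A B hS hcard hAB _ _ ihA ihB =>
    intro hsub
    exact (H.subset_or_subset_of_separation hH hcard hAB
      (hsub.trans (Finset.coe_subset.2 hS))).elim ihA ihB

theorem IsSeparable.fragile [Fintype V] (h : G.IsSeparable Finset.univ) : G.Fragile :=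
  fun _ hH => h.not_verts_subset hH (by simp)

end SimpleGraph

/-- Neighbourhoods in a 4-regular fragile graph. The vertices `2, …, 7` and `8, …, 13` induce two
copies of the join of two isolated vertices with two disjoint edges; each of the vertices
`0` and `1` is joined to one end of each of these four edges. -/
def fragileNeighbors : Fin 14 → Finset (Fin 14) :=
  ![{4, 6, 10, 12}, {5, 7, 11, 13},
    {4, 5, 6, 7}, {4, 5, 6, 7}, {0, 2, 3, 5}, {1, 2, 3, 4}, {0, 2, 3, 7}, {1, 2, 3, 6},
    {10, 11, 12, 13}, {10, 11, 12, 13}, {0, 8, 9, 11}, {1, 8, 9, 10}, {0, 8, 9, 13},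
    {1, 8, 9, 12}]

/-- A 4-regular fragile graph on 14 vertices. -/
def fragileGraph : SimpleGraph (Fin 14) where
  Adj u v := v ∈ fragileNeighbors u
  symm := ⟨by decide⟩
  loopless := ⟨by decide⟩

instance : DecidableRel fragileGraph.Adj :=
  fun u v => inferInstanceAs (Decidable (v ∈ fragileNeighbors u))

theorem isSeparable_fragileGraph : fragileGraph.IsSeparable Finset.univ := by
  refine .separation {0, 1, 2, 3, 4, 5, 6, 7} {0, 1, 8, 9, 10, 11, 12, 13}
    (by decide) (by decide) (by decide) ?_ ?_
  · refine .separation {0, 4, 6} {1, 2, 3, 4, 5, 6, 7} (by decide) (by decide) (by decide)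
      (.small (by decide)) ?_
    refine .separation {1, 5, 7} {2, 3, 4, 5, 6, 7} (by decide) (by decide) (by decide)
      (.small (by decide)) ?_
    refine .separation {2, 3, 4, 5} {2, 3, 6, 7} (by decide) (by decide) (by decide) ?_ ?_
    · exact .separation {2, 4, 5} {3, 4, 5} (by decide) (by decide) (by decide)
        (.small (by decide)) (.small (by decide))
    · exact .separation {2, 6, 7} {3, 6, 7} (by decide) (by decide) (by decide)
        (.small (by decide)) (.small (by decide))
  · refine .separation {0, 10, 12} {1, 8, 9, 10, 11, 12, 13} (by decide) (by decide) (by decide)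
      (.small (by decide)) ?_
    refine .separation {1, 11, 13} {8, 9, 10, 11, 12, 13} (by decide) (by decide) (by decide)
      (.small (by decide)) ?_
    refine .separation {8, 9, 10, 11} {8, 9, 12, 13} (by decide) (by decide) (by decide) ?_ ?_
    · exact .separation {8, 10, 11} {9, 10, 11} (by decide) (by decide) (by decide)
        (.small (by decide)) (.small (by decide))
    · exact .separation {8, 12, 13} {9, 12, 13} (by decide) (by decide) (by decide)
        (.small (by decide)) (.small (by decide))

theorem degree_fragileGraph (v : Fin 14) : fragileGraph.degree v = 4 := by
  revert v
  decide

/-- There is a fragile graph whose minimum degree is (exactly) 4. -/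
theorem statement15 :
    ∃ (V : Type) (_ : Fintype V) (G : SimpleGraph V) (_ : DecidableRel G.Adj),
      Nonempty V ∧ G.Fragile ∧ (∀ v : V, 4 ≤ G.degree v) ∧ (∃ v : V, G.degree v = 4) :=
  ⟨Fin 14, inferInstance, fragileGraph, inferInstance, inferInstance,
    isSeparable_fragileGraph.fragile, fun v => (degree_fragileGraph v).ge,
    0, degree_fragileGraph 0⟩
end

section
/- There exists a triangle-free fragile finite simple graph with chromatic number exactly 4 (equivalently, a fragile graph of girth at least 4 that is not 3-colourable). -/
namespace SimpleGraph

section Fragile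

variable {V : Type*} {G : SimpleGraph V}

/-- A 3-connected subgraph lies on one side of every separation of order at most two. -/
theorem IsKConnected.verts_subset_or_verts_subset {H : G.Subgraph} (hH : H.coe.IsKConnected 3)
    {A B : Set V} (hAB : H.verts ⊆ A ∪ B) (hfin : (A ∩ B).Finite) (hcard : (A ∩ B).ncard ≤ 2)
    (hcross : ∀ a ∈ H.verts, ∀ b ∈ H.verts, a ∉ B → b ∉ A → ¬ G.Adj a b) :
    H.verts ⊆ A ∨ H.verts ⊆ B := by
  by_contra! hne
  obtain ⟨p, hpW, hpA⟩ := Set.not_subset.1 hne.1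
  obtain ⟨q, hqW, hqB⟩ := Set.not_subset.1 hne.2
  have hqA : q ∈ A := (hAB hqW).resolve_right hqB
  let S : Set H.verts := Subtype.val ⁻¹' (A ∩ B)
  have hS : S.ncard ≤ 3 - 1 := by
    rw [← Set.ncard_image_of_injective S Subtype.val_injective]
    exact (Set.ncard_le_ncard (Set.image_preimage_subset _ _) hfin).trans hcard
  have hreach := (hH.2 S hS).preconnected
    ⟨⟨q, hqW⟩, fun h => hqB h.2⟩ ⟨⟨p, hpW⟩, fun h => hpA h.1⟩
  rw [reachable_iff_reflTransGen] at hreach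
  refine hpA (Relation.ReflTransGen.head_induction_on
    (motive := fun x _ => x.1.1 ∈ A → p ∈ A) hreach id (fun {x y} hxy _ ih hx => ih ?_) hqA)
  by_contra hy
  exact hcross x.1.1 x.1.2 y.1.1 y.1.2 (fun hB => x.2 ⟨hx, hB⟩) hy (H.adj_sub hxy)

/-- Every vertex of a 3-connected subgraph has at least three neighbours in it. -/
theorem IsKConnected.two_lt_ncard_neighbors {H : G.Subgraph} (hH : H.coe.IsKConnected 3)
    {v : V} (hv : v ∈ H.verts) {N : Set V} (hN : N.Finite)
    (hadj : ∀ w ∈ H.verts, G.Adj v w → w ∈ N) : 2 < N.ncard := by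
  by_contra! hle
  have hsub : insert v N ∩ {v}ᶜ ⊆ N := by
    rintro x ⟨hx | hx, hxv⟩
    exacts [absurd hx hxv, hx]
  rcases hH.verts_subset_or_verts_subset (A := insert v N) (B := {v}ᶜ)
      (fun x _ => by by_cases h : x = v <;> simp [h]) (hN.subset hsub)
      ((Set.ncard_le_ncard hsub hN).trans hle)
      (fun a _ b hb ha hbA hab => hbA (Or.inr (hadj b hb (by
        obtain rfl : a = v := by simpa using ha
        exact hab)))) with h | h
  · have h4 : 3 + 1 ≤ H.verts.ncard := hH.1
    have := Set.ncard_le_ncard h (hN.insert v)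
    have := Set.ncard_insert_le v N
    omega
  · exact h hv rfl

/-- A 3-connected subgraph is not contained in a set of vertices that can be ordered in such a
way that every vertex has at most two neighbours preceding it. -/
theorem IsKConnected.not_verts_subset_of_degenerate [DecidableRel G.Adj] {H : G.Subgraph}
    (hH : H.coe.IsKConnected 3) (f : V → ℕ) (s : Finset V)
    (hs : ∀ v ∈ s, (s.filter fun w => G.Adj v w ∧ f w ≤ f v).card ≤ 2) :
    ¬ H.verts ⊆ s := by
  intro hsub
  have hne : H.verts.Nonempty := by
    apply Set.nonempty_of_ncard_ne_zero
    have h4 : 3 + 1 ≤ H.verts.ncard := hH.1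
    omega
  obtain ⟨v, hv, hmax⟩ := (s.finite_toSet.subset hsub).exists_maximalFor f _ hne
  have hlt := hH.two_lt_ncard_neighbors hv
    (N := (s.filter fun w => G.Adj v w ∧ f w ≤ f v : Finset V)) (Finset.finite_toSet _)
    (fun w hw hvw => by
      simp only [Finset.coe_filter, Set.mem_ofPred_eq]
      exact ⟨hsub hw, hvw, (le_total (f w) (f v)).elim id (hmax hw)⟩)
  rw [Set.ncard_coe_finset] at hlt
  exact absurd (hs v (hsub hv)) (by omega)

end Fragile

/-- The edges of a triangle-free 2-degenerate graph on twelve vertices in which the nonadjacent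
vertices `0` and `11` receive different colours in every 3-colouring. -/
def gadgetEdges : List (Fin 12 × Fin 12) :=
  [(1, 2), (0, 3), (2, 3), (1, 4), (3, 4), (0, 5), (1, 5), (2, 6), (5, 6), (4, 7), (6, 7), (0, 8),
    (7, 8), (5, 9), (8, 9), (3, 10), (8, 10), (9, 11), (10, 11)]

/-- The graph with edge list `gadgetEdges`. -/
def gadget : SimpleGraph (Fin 12) where
  Adj i j := (i, j) ∈ gadgetEdges ∨ (j, i) ∈ gadgetEdges
  symm := ⟨fun _ _ h => h.symm⟩
  loopless := ⟨by decide⟩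

instance : DecidableRel gadget.Adj := fun i j =>
  inferInstanceAs (Decidable ((i, j) ∈ gadgetEdges ∨ (j, i) ∈ gadgetEdges))

/-- Two copies of `gadget`, the vertices `0` and `11` of the first being joined to the vertices
`0` and `11` of the second. -/
def doubleGadget : SimpleGraph (Fin 12 ⊕ Fin 12) where
  Adj
    | .inl i, .inl j => gadget.Adj i j
    | .inr i, .inr j => gadget.Adj i j
    | .inl i, .inr j => (i = 0 ∨ i = 11) ∧ (j = 0 ∨ j = 11)
    | .inr i, .inl j => (i = 0 ∨ i = 11) ∧ (j = 0 ∨ j = 11)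
  symm := ⟨by
    rintro (i | i) (j | j) h
    exacts [Adj.symm (G := gadget) h, h.symm, h.symm, Adj.symm (G := gadget) h]⟩
  loopless := ⟨by
    rintro (i | i) h
    exacts [gadget.irrefl h, gadget.irrefl h]⟩

instance : DecidableRel doubleGadget.Adj
  | .inl i, .inl j => inferInstanceAs (Decidable (gadget.Adj i j))
  | .inr i, .inr j => inferInstanceAs (Decidable (gadget.Adj i j))
  | .inl i, .inr j => inferInstanceAs (Decidable ((i = 0 ∨ i = 11) ∧ (j = 0 ∨ j = 11)))
  | .inr i, .inl j => inferInstanceAs (Decidable ((i = 0 ∨ i = 11) ∧ (j = 0 ∨ j = 11)))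

set_option maxRecDepth 10000 in
theorem gadget_coloring_ne (c : gadget.Coloring (Fin 3)) : c 0 ≠ c 11 := by
  have key : ∀ c0 c1 c2 : Fin 3, c1 ≠ c2 → ∀ c3, c0 ≠ c3 → c2 ≠ c3 →
      ∀ c4, c1 ≠ c4 → c3 ≠ c4 → ∀ c5, c0 ≠ c5 → c1 ≠ c5 → ∀ c6, c2 ≠ c6 → c5 ≠ c6 →
      ∀ c7, c4 ≠ c7 → c6 ≠ c7 → ∀ c8, c0 ≠ c8 → c7 ≠ c8 → ∀ c9, c5 ≠ c9 → c8 ≠ c9 →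
      ∀ c10, c3 ≠ c10 → c8 ≠ c10 → ∀ c11, c9 ≠ c11 → c10 ≠ c11 → c0 ≠ c11 := by
    decide
  have h : ∀ i j, gadget.Adj i j → c i ≠ c j := fun i j => c.valid
  exact key (c 0) (c 1) (c 2) (h _ _ (by decide)) (c 3) (h _ _ (by decide)) (h _ _ (by decide))
    (c 4) (h _ _ (by decide)) (h _ _ (by decide)) (c 5) (h _ _ (by decide)) (h _ _ (by decide))
    (c 6) (h _ _ (by decide)) (h _ _ (by decide)) (c 7) (h _ _ (by decide)) (h _ _ (by decide))
    (c 8) (h _ _ (by decide)) (h _ _ (by decide)) (c 9) (h _ _ (by decide)) (h _ _ (by decide))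
    (c 10) (h _ _ (by decide)) (h _ _ (by decide)) (c 11) (h _ _ (by decide)) (h _ _ (by decide))

theorem doubleGadget_not_colorable : ¬ doubleGadget.Colorable 3 := by
  rintro ⟨c⟩
  have hl : c (.inl 0) ≠ c (.inl 11) :=
    gadget_coloring_ne (Coloring.mk (fun i => c (.inl i))
      fun {i j} h => c.valid (v := .inl i) (w := .inl j) h)
  have hr : c (.inr 0) ≠ c (.inr 11) :=
    gadget_coloring_ne (Coloring.mk (fun i => c (.inr i))
      fun {i j} h => c.valid (v := .inr i) (w := .inr j) h)
  have h00 : c (.inl 0) ≠ c (.inr 0) := c.valid (by decide)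
  have h01 : c (.inl 0) ≠ c (.inr 11) := c.valid (by decide)
  have h10 : c (.inl 11) ≠ c (.inr 0) := c.valid (by decide)
  have h11 : c (.inl 11) ≠ c (.inr 11) := c.valid (by decide)
  generalize c (.inl 0) = x at *
  generalize c (.inl 11) = y at *
  generalize c (.inr 0) = z at *
  generalize c (.inr 11) = w at *
  revert x y z w
  decide

theorem doubleGadget_colorable : doubleGadget.Colorable 4 :=
  ⟨Coloring.mk
    (Sum.elim ![0, 0, 1, 2, 1, 1, 0, 2, 1, 0, 0, 1] ![2, 0, 1, 0, 1, 1, 0, 2, 0, 2, 1, 3])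
    fun {v w} => by revert v w; decide⟩

theorem doubleGadget_cliqueFree : doubleGadget.CliqueFree 3 := by
  have key : ∀ i j, doubleGadget.Adj i j → ∀ k, doubleGadget.Adj i k → ¬ doubleGadget.Adj j k := by
    decide
  intro t ht
  obtain ⟨a, b, c, hab, hac, hbc, -⟩ := is3Clique_iff.1 ht
  exact key a b hab c hac hbc

theorem doubleGadget_fragile : doubleGadget.Fragile := by
  intro H hH
  let A : Finset (Fin 12 ⊕ Fin 12) :=
    Finset.univ.filter fun v => v.isLeft ∨ v = .inr 0 ∨ v = .inr 11
  let B : Finset (Fin 12 ⊕ Fin 12) := Finset.univ.filter fun v => v.isRight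
  let f : Fin 12 ⊕ Fin 12 → ℕ := Sum.elim (fun i => i) (fun i => 12 + i)
  have hcover : ∀ v, v ∈ A ∨ v ∈ B := by decide
  have hcross : ∀ a b, a ∉ B → b ∉ A → ¬ doubleGadget.Adj a b := by decide
  rcases hH.verts_subset_or_verts_subset (A := A) (B := B) (fun v _ => hcover v)
      (Set.toFinite _) (by rw [← Finset.coe_inter, Set.ncard_coe_finset]; decide)
      (fun a _ b _ => hcross a b) with h | h
  · exact hH.not_verts_subset_of_degenerate f A (by decide) h
  · exact hH.not_verts_subset_of_degenerate f B (by decide) h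

end SimpleGraph

/-- There is a triangle-free fragile graph with chromatic number exactly 4. -/
theorem statement17 :
    ∃ (V : Type) (_ : Fintype V) (G : SimpleGraph V),
      G.CliqueFree 3 ∧ G.Fragile ∧ G.chromaticNumber = 4 := by
  exact ⟨Fin 12 ⊕ Fin 12, inferInstance, SimpleGraph.doubleGadget,
    SimpleGraph.doubleGadget_cliqueFree, SimpleGraph.doubleGadget_fragile,
    SimpleGraph.chromaticNumber_eq_iff_colorable_not_colorable.2
      ⟨SimpleGraph.doubleGadget_colorable, SimpleGraph.doubleGadget_not_colorable⟩⟩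
end
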